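/- With the block fundamental-solution setup below, for all t ≥ 0 the following operator-norm bounds hold: ‖A(t) − I‖₂ ≤ cosh(√L·t) − 1, ‖B(t) − t·I‖₂ ≤ sinh(√L·t)/√L − t, and ‖D(t) − I‖₂ ≤ cosh(√L·t) − 1. -/

import Mathlib

/-- The operator norm of a real `d × d` matrix induced by the Euclidean norm on `ℝ^d`. -/
noncomputable def opNorm2 {d : ℕ} (A : Matrix (Fin d) (Fin d) ℝ) : ℝ :=
  ‖LinearMap.toContinuousLinearMap (Matrix.toEuclideanLin A)‖

theorem norm_le_of_hasDerivAt_of_norm_deriv_le {E : Type*} [NormedAddCommGroup E]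
    [NormedSpace ℝ E] {f f' : ℝ → E} {g g' : ℝ → ℝ} {T : ℝ} (hf0 : f 0 = 0) (hg0 : g 0 = 0)
    (hf : ∀ t, 0 ≤ t → HasDerivAt f (f' t) t) (hg : ∀ t, HasDerivAt g (g' t) t)
    (hle : ∀ t ∈ Set.Icc 0 T, ‖f' t‖ ≤ g' t) :
    ∀ t ∈ Set.Icc 0 T, ‖f t‖ ≤ g t := by
  intro t ht
  refine image_norm_le_of_norm_deriv_right_le_deriv_boundary (a := 0) (b := T)
    (fun x hx => (hf x hx.1).continuousAt.continuousWithinAt)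
    (fun x hx => (hf x hx.1).hasDerivWithinAt) (by simp [hf0, hg0]) hg
    (fun x hx => hle x ⟨hx.1, hx.2.le⟩) ht

section SecondOrder

variable {E : Type*} [NormedAddCommGroup E] [NormedSpace ℝ E] {X Y G : ℝ → E} {L : ℝ}

/-- A bound on `‖X‖` improves to bounds on the first-order Taylor remainders of `X` and
its derivative `Y` when the second derivative has norm at most `L * ‖X‖`. -/
theorem taylor_remainder_norm_le (hL : 0 ≤ L) (hX : ∀ t, 0 ≤ t → HasDerivAt X (Y t) t)
    (hY : ∀ t, 0 ≤ t → HasDerivAt Y (G t) t) (hG : ∀ t, 0 ≤ t → ‖G t‖ ≤ L * ‖X t‖)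
    {h p q : ℝ → ℝ} {T : ℝ} (hp : ∀ t, HasDerivAt p (q t) t)
    (hq : ∀ t, HasDerivAt q (L * h t) t) (hh : ∀ t ∈ Set.Icc 0 T, ‖X t‖ ≤ h t) :
    ∀ t ∈ Set.Icc 0 T, ‖Y t - Y 0‖ ≤ q t - q 0 ∧
      ‖X t - X 0 - t • Y 0‖ ≤ p t - p 0 - t * q 0 := by
  have hYle : ∀ t ∈ Set.Icc 0 T, ‖Y t - Y 0‖ ≤ q t - q 0 :=
    norm_le_of_hasDerivAt_of_norm_deriv_le (f := fun t => Y t - Y 0) (g := fun t => q t - q 0)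
      (by simp) (by simp)
      (fun t ht => (hY t ht).sub_const _) (fun t => (hq t).sub_const _)
      fun t ht => (hG t ht.1).trans (mul_le_mul_of_nonneg_left (hh t ht) hL)
  have hXle : ∀ t ∈ Set.Icc 0 T, ‖X t - X 0 - t • Y 0‖ ≤ p t - p 0 - t * q 0 :=
    norm_le_of_hasDerivAt_of_norm_deriv_le (f := fun t => X t - X 0 - t • Y 0)
      (g := fun t => p t - p 0 - t * q 0) (by simp) (by simp)
      (fun t ht => by
        simpa using ((hX t ht).sub_const (X 0)).fun_sub ((hasDerivAt_id t).smul_const (Y 0)))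
      (fun t => by
        simpa using ((hp t).sub_const (p 0)).fun_sub ((hasDerivAt_id t).mul_const (q 0)))
      hYle
  exact fun t ht => ⟨hYle t ht, hXle t ht⟩

theorem hasDerivAt_cosh_const_mul (c t : ℝ) :
    HasDerivAt (fun s => Real.cosh (c * s)) (c * Real.sinh (c * t)) t := by
  simpa [mul_comm] using ((hasDerivAt_id t).const_mul c).cosh

theorem hasDerivAt_sinh_const_mul (c t : ℝ) :
    HasDerivAt (fun s => Real.sinh (c * s)) (c * Real.cosh (c * t)) t := by
  simpa [mul_comm] using ((hasDerivAt_id t).const_mul c).sinh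

/-- Comparison with a scalar majorant `u` whose second derivative is `L * u`. -/
theorem norm_le_of_second_order_majorant (hL : 0 ≤ L)
    (hX : ∀ t, 0 ≤ t → HasDerivAt X (Y t) t)
    (hY : ∀ t, 0 ≤ t → HasDerivAt Y (G t) t) (hG : ∀ t, 0 ≤ t → ‖G t‖ ≤ L * ‖X t‖)
    {u v : ℝ → ℝ} (hu : ∀ t, HasDerivAt u (v t) t) (hv : ∀ t, HasDerivAt v (L * u t) t)
    (hu0 : ‖X 0‖ ≤ u 0) (hv0 : ‖Y 0‖ ≤ v 0) {t : ℝ} (ht : 0 ≤ t) : ‖X t‖ ≤ u t := by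
  set c := 2 * √L with hc
  have hcc : c * c = 4 * L := by
    rw [hc, mul_mul_mul_comm, Real.mul_self_sqrt hL]; norm_num
  have hcont : ContinuousOn (fun s => ‖X s‖ - u s) (Set.Icc 0 t) := fun s hs =>
    ((hX s hs.1).continuousAt.norm.sub (hu s).continuousAt).continuousWithinAt
  obtain ⟨K, hK⟩ := isCompact_Icc.bddAbove_image hcont
  have hKle : ∀ s ∈ Set.Icc 0 t, ‖X s‖ - u s ≤ K := fun s hs => hK ⟨s, hs, rfl⟩
  have iterate : ∀ n : ℕ, ∀ s ∈ Set.Icc 0 t,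
      ‖X s‖ ≤ u s + |K| * (1 / 4) ^ n * Real.cosh (c * s) := by
    intro n
    induction n with
    | zero =>
      intro s hs
      have h1 := hKle s hs
      have h2 := mul_le_mul_of_nonneg_left (Real.one_le_cosh (c * s)) (abs_nonneg K)
      have h3 := le_abs_self K
      simp only [pow_zero, mul_one] at h2 ⊢
      linarith
    | succ n ih =>
      intro s hs
      set a := |K| * (1 / 4) ^ (n + 1) with ha
      have ha0 : 0 ≤ a := by positivity
      have key := (taylor_remainder_norm_le hL hX hY hG
        (p := fun r => u r + a * Real.cosh (c * r))
        (q := fun r => v r + a * (c * Real.sinh (c * r)))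
        (fun r => (hu r).add ((hasDerivAt_cosh_const_mul c r).const_mul a))
        (fun r => by
          refine ((hv r).add
            (((hasDerivAt_sinh_const_mul c r).const_mul c).const_mul a)).congr_deriv ?_
          rw [ha, ← mul_assoc c c, hcc]
          ring) ih s hs).2
      have tri : ‖X s‖ ≤ ‖X s - X 0 - s • Y 0‖ + ‖X 0‖ + s * ‖Y 0‖ := by
        calc ‖X s‖ = ‖(X s - X 0 - s • Y 0) + X 0 + s • Y 0‖ := by congr 1; abel
          _ ≤ _ := norm_add₃_le
          _ = _ := by rw [norm_smul, Real.norm_of_nonneg hs.1]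
      have hsv := mul_le_mul_of_nonneg_left hv0 hs.1
      simp only [mul_zero, Real.cosh_zero, Real.sinh_zero, mul_one, add_zero] at key
      linarith
  have lim : Filter.Tendsto (fun n : ℕ => u t + |K| * (1 / 4) ^ n * Real.cosh (c * t))
      Filter.atTop (nhds (u t)) := by
    have h := ((tendsto_pow_atTop_nhds_zero_of_lt_one (r := (1 / 4 : ℝ)) (by norm_num)
      (by norm_num)).const_mul |K|).mul_const (Real.cosh (c * t))
    simpa using h.const_add (u t)
  exact ge_of_tendsto' lim fun n => iterate n t ⟨ht, le_rfl⟩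

theorem taylor_remainder_norm_le_of_second_order_majorant (hL : 0 ≤ L)
    (hX : ∀ t, 0 ≤ t → HasDerivAt X (Y t) t)
    (hY : ∀ t, 0 ≤ t → HasDerivAt Y (G t) t) (hG : ∀ t, 0 ≤ t → ‖G t‖ ≤ L * ‖X t‖)
    {u v : ℝ → ℝ} (hu : ∀ t, HasDerivAt u (v t) t) (hv : ∀ t, HasDerivAt v (L * u t) t)
    (hu0 : ‖X 0‖ ≤ u 0) (hv0 : ‖Y 0‖ ≤ v 0) {t : ℝ} (ht : 0 ≤ t) :
    ‖Y t - Y 0‖ ≤ v t - v 0 ∧ ‖X t - X 0 - t • Y 0‖ ≤ u t - u 0 - t * v 0 :=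
  taylor_remainder_norm_le hL hX hY hG hu hv
    (fun _ hs => norm_le_of_second_order_majorant hL hX hY hG hu hv hu0 hv0 hs.1) t ⟨ht, le_rfl⟩

end SecondOrder

section MatrixNorm

open scoped Matrix.Norms.L2Operator

theorem opNorm2_eq_norm {d : ℕ} (A : Matrix (Fin d) (Fin d) ℝ) : opNorm2 A = ‖A‖ := by
  rw [Matrix.l2_opNorm_def]; rfl

theorem Matrix.hasDerivAt_of_entries {d : ℕ} {A : ℝ → Matrix (Fin d) (Fin d) ℝ}
    {A' : Matrix (Fin d) (Fin d) ℝ} {t : ℝ}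
    (h : ∀ i j, HasDerivAt (fun s => A s i j) (A' i j) t) : HasDerivAt A A' t := by
  have key : HasDerivAt (fun s => ∑ i, ∑ j, A s i j • Matrix.single i j (1 : ℝ))
      (∑ i, ∑ j, A' i j • Matrix.single i j (1 : ℝ)) t :=
    HasDerivAt.fun_sum fun i _ => HasDerivAt.fun_sum fun j _ => (h i j).smul_const _
  simpa only [Matrix.smul_single, smul_eq_mul, mul_one, ← Matrix.matrix_eq_sum_single] using key

/-- Taylor remainder bounds for matrix functions `X` whose second derivative is `M * X`. -/
theorem opNorm2_taylor_remainder_le {d : ℕ} {L : ℝ} (hL : 0 ≤ L)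
    {M X Y : ℝ → Matrix (Fin d) (Fin d) ℝ} (hM : ∀ t, 0 ≤ t → opNorm2 (M t) ≤ L)
    (hX : ∀ t, 0 ≤ t → ∀ i j, HasDerivAt (fun s => X s i j) (Y t i j) t)
    (hY : ∀ t, 0 ≤ t → ∀ i j, HasDerivAt (fun s => Y s i j) ((M t * X t) i j) t)
    {u v : ℝ → ℝ} (hu : ∀ t, HasDerivAt u (v t) t) (hv : ∀ t, HasDerivAt v (L * u t) t)
    (hu0 : opNorm2 (X 0) ≤ u 0) (hv0 : opNorm2 (Y 0) ≤ v 0) {t : ℝ} (ht : 0 ≤ t) :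
    opNorm2 (Y t - Y 0) ≤ v t - v 0 ∧
      opNorm2 (X t - X 0 - t • Y 0) ≤ u t - u 0 - t * v 0 := by
  simp only [opNorm2_eq_norm] at *
  exact taylor_remainder_norm_le_of_second_order_majorant hL
    (fun s hs => Matrix.hasDerivAt_of_entries (hX s hs))
    (fun s hs => Matrix.hasDerivAt_of_entries (hY s hs))
    (fun s hs => (norm_mul_le _ _).trans (mul_le_mul_of_nonneg_right (hM s hs) (norm_nonneg _)))
    hu hv hu0 hv0 ht

theorem opNorm2_zero {d : ℕ} : opNorm2 (0 : Matrix (Fin d) (Fin d) ℝ) = 0 := by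
  rw [opNorm2_eq_norm, norm_zero]

theorem opNorm2_one_le {d : ℕ} : opNorm2 (1 : Matrix (Fin d) (Fin d) ℝ) ≤ 1 := by
  rw [opNorm2_eq_norm, ← Matrix.l2_opNorm_toEuclideanCLM, map_one]
  exact ContinuousLinearMap.norm_id_le

end MatrixNorm

/-- Lemma `matrix-exponent-block-bounds`, second set of bounds: for the block
fundamental solution `[[A,B],[C,D]]` of `[[0,I],[M(t),0]]` with `‖M(t)‖₂ ≤ L`,
one has `‖A(t) − I‖₂ ≤ cosh(√L t) − 1`, `‖B(t) − t·I‖₂ ≤ sinh(√L t)/√L − t`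
and `‖D(t) − I‖₂ ≤ cosh(√L t) − 1` for all `t ≥ 0`. -/
theorem stmt_5 (d : ℕ) (L : ℝ) (hL : 0 < L)
    (M : ℝ → Matrix (Fin d) (Fin d) ℝ) (hMcont : Continuous M)
    (hMbound : ∀ t, 0 ≤ t → opNorm2 (M t) ≤ L)
    (A B C D : ℝ → Matrix (Fin d) (Fin d) ℝ)
    (hA0 : A 0 = 1) (hB0 : B 0 = 0) (hC0 : C 0 = 0) (hD0 : D 0 = 1)
    (hA : ∀ t, 0 ≤ t → ∀ i j, HasDerivAt (fun s => A s i j) (C t i j) t)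
    (hB : ∀ t, 0 ≤ t → ∀ i j, HasDerivAt (fun s => B s i j) (D t i j) t)
    (hC : ∀ t, 0 ≤ t → ∀ i j, HasDerivAt (fun s => C s i j) ((M t * A t) i j) t)
    (hD : ∀ t, 0 ≤ t → ∀ i j, HasDerivAt (fun s => D s i j) ((M t * B t) i j) t) :
    ∀ t, 0 ≤ t →
      opNorm2 (A t - 1) ≤ Real.cosh (Real.sqrt L * t) - 1 ∧
      opNorm2 (B t - t • (1 : Matrix (Fin d) (Fin d) ℝ)) ≤
        Real.sinh (Real.sqrt L * t) / Real.sqrt L - t ∧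
      opNorm2 (D t - 1) ≤ Real.cosh (Real.sqrt L * t) - 1 := by
  intro t ht
  have hs : √L ≠ 0 := (Real.sqrt_pos.2 hL).ne'
  have hss : √L * √L = L := Real.mul_self_sqrt hL.le
  have hAC := opNorm2_taylor_remainder_le hL.le hMbound hA hC
    (u := fun s => Real.cosh (√L * s)) (v := fun s => √L * Real.sinh (√L * s))
    (hasDerivAt_cosh_const_mul _)
    (fun s => by
      simpa [← mul_assoc, hss] using (hasDerivAt_sinh_const_mul (√L) s).const_mul (√L))
    (by simpa [hA0] using opNorm2_one_le) (by simp [hC0, opNorm2_zero]) ht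
  have hBD := opNorm2_taylor_remainder_le hL.le hMbound hB hD
    (u := fun s => Real.sinh (√L * s) / √L) (v := fun s => Real.cosh (√L * s))
    (fun s => by
      simpa [hs] using (hasDerivAt_sinh_const_mul (√L) s).div_const (√L))
    (fun s => by
      refine (hasDerivAt_cosh_const_mul (√L) s).congr_deriv ?_
      rw [← mul_div_assoc, eq_div_iff hs]
      linear_combination Real.sinh (√L * s) * hss)
    (by simp [hB0, opNorm2_zero]) (by simpa [hD0] using opNorm2_one_le) ht
  simp only [hA0, hC0, smul_zero, sub_zero, mul_zero, Real.cosh_zero, Real.sinh_zero] at hAC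
  simp only [hB0, hD0, sub_zero, mul_zero, mul_one, Real.cosh_zero, Real.sinh_zero,
    zero_div] at hBD
  exact ⟨hAC.2, hBD.2, hBD.1⟩
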